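/- Let p ≥ 1 and q ≥ 2 be integers, let G̃ be the complete graph K_{2q−1} on 2q−1 vertices (so |Ẽ| = (2q−1)(q−1)), and let A be any finite field. With capacity parameter α = p, the Construction-1 sum-network built from K_{2q−1} has capacity exactly p/q: there exists a Construction-1 (p(2q−1), q(2q−1))-code of capacity p, and every Construction-1 (r,l)-code of capacity p satisfies r·q ≤ l·p. (This recovers the result of Rai–Das that for any positive integers p, q there is a sum-network of capacity p/q.) -/

import Mathlib

/-- Source index set for Construction 1: one source per vertex and one per edge. -/
abbrev Src1 {V : Type} (G : SimpleGraph V) : Type := V ⊕ ↥G.edgeSet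

/-- The set `A_i` of sources connected to the tail of bottleneck edge `e_i` in
Construction 1: the vertex source `i` and the edge sources of edges incident to `i`. -/
def A1 {V : Type} (G : SimpleGraph V) (i : V) : Set (Src1 G) :=
  fun s => match s with
  | Sum.inl j => j = i
  | Sum.inr e => i ∈ (e : Sym2 V)

/-- A Construction-1 `(r,l)`-code of capacity `α` over the finite field `A`:
encoding functions `φ i` on each bottleneck edge (depending only on the sources in `A_i`),
such that (i) each vertex-terminal `t_i`, (ii) each edge-terminal `t_e`, and
(iii) the starred terminal `t_⋆` can decode the sum of all sources. -/
def IsCode1 {V : Type} [Fintype V] [DecidableEq V] (G : SimpleGraph V)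
    [DecidableRel G.Adj] (A : Type) [Field A] [Fintype A] (r l α : ℕ)
    (φ : ∀ i : V, (↥(A1 G i) → (Fin r → A)) → (Fin (α * l) → A)) : Prop :=
  (∀ i : V,
    ∃ ψ : (Fin (α * l) → A) → (↥((A1 G i)ᶜ) → (Fin r → A)) → (Fin r → A),
      ∀ x : Src1 G → (Fin r → A),
        ψ (φ i (fun a => x a.1)) (fun a => x a.1) = ∑ s, x s) ∧
  (∀ i j : V, G.Adj i j →
    ∃ ψ : (Fin (α * l) → A) → (Fin (α * l) → A) →
        (↥((A1 G i ∪ A1 G j)ᶜ) → (Fin r → A)) → (Fin r → A),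
      ∀ x : Src1 G → (Fin r → A),
        ψ (φ i (fun a => x a.1)) (φ j (fun a => x a.1)) (fun a => x a.1) = ∑ s, x s) ∧
  (∃ ψ : (V → (Fin (α * l) → A)) → (Fin r → A),
      ∀ x : Src1 G → (Fin r → A),
        ψ (fun i => φ i (fun a => x a.1)) = ∑ s, x s)

/-- A feasible CODE-FEAS-1 assignment: nonnegative integers `m e i` for each edge `e` and
endpoint `i` of `e` with `m e i + m e j = |Ṽ|` for every edge `e = {i,j}` and
`∑_{e ∋ i} m e i ≤ |Ẽ|` for every vertex `i`. -/
def Feas1 {V : Type} [Fintype V] [DecidableEq V] (G : SimpleGraph V)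
    [DecidableRel G.Adj] (m : Sym2 V → V → ℕ) : Prop :=
  (∀ i j : V, G.Adj i j → m s(i, j) i + m s(i, j) j = Fintype.card V) ∧
  (∀ i : V, ∑ e ∈ G.edgeFinset.filter (fun e => i ∈ e), m e i ≤ G.edgeFinset.card)

/-- A map that is constant on the fibres of `a` factors through `a`. -/
theorem exists_decoder {X Y Z : Type*} [Nonempty Z] (a : X → Y) (f : X → Z)
    (h : ∀ x y, a x = a y → f x = f y) : ∃ ψ : Y → Z, ∀ x, ψ (a x) = f x := by
  classical
  exact ⟨Function.extend a f fun _ => Classical.arbitrary Z,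
    fun x => Function.FactorsThrough.extend_apply (fun x y hxy => h x y hxy) _ x⟩

theorem A1_inter {V : Type} (G : SimpleGraph V) {i j : V} (h : G.Adj i j) :
    A1 G i ∩ A1 G j = {Sum.inr ⟨s(i, j), h⟩} := by
  ext s
  rcases s with v | e
  · refine ⟨fun hv => ?_, fun hv => by cases hv⟩
    obtain ⟨hi, hj⟩ : v = i ∧ v = j := hv
    exact absurd (hi.symm.trans hj) h.ne
  · rw [Set.mem_singleton_iff, Sum.inr.injEq, Subtype.ext_iff]
    exact Sym2.mem_and_mem_iff h.ne

section Sources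

variable {V : Type} [Fintype V] (G : SimpleGraph V) [DecidableRel G.Adj]
  {M : Type*} [AddCommGroup M]

/-- The sum of the sources lying in `T`. -/
noncomputable def partialSum (T : Set (Src1 G)) (x : Src1 G → M) : M :=
  ∑ s, T.indicator x s

theorem partialSum_congr {T : Set (Src1 G)} {x y : Src1 G → M} (h : ∀ s ∈ T, x s = y s) :
    partialSum G T x = partialSum G T y := by
  unfold partialSum
  rw [Set.indicator_congr h]

theorem partialSum_add_compl (T : Set (Src1 G)) (x : Src1 G → M) :
    partialSum G T x + partialSum G Tᶜ x = ∑ s, x s := by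
  unfold partialSum
  rw [← Finset.sum_add_distrib]
  refine Finset.sum_congr rfl fun s _ => ?_
  rw [← Pi.add_apply, Set.indicator_self_add_compl]

theorem partialSum_singleton (s : Src1 G) (x : Src1 G → M) : partialSum G {s} x = x s := by
  unfold partialSum
  rw [Finset.sum_eq_single s] <;> simp +contextual [Set.indicator]

theorem partialSum_union {i j : V} (h : G.Adj i j) (x : Src1 G → M) :
    partialSum G (A1 G i ∪ A1 G j) x + x (Sum.inr ⟨s(i, j), h⟩) =
      partialSum G (A1 G i) x + partialSum G (A1 G j) x := by
  rw [← partialSum_singleton G (Sum.inr ⟨s(i, j), h⟩) x, ← A1_inter G h]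
  unfold partialSum
  rw [← Finset.sum_add_distrib, ← Finset.sum_add_distrib]
  exact Finset.sum_congr rfl fun s _ => Set.indicator_union_add_inter_apply x _ _ s

/-- The sources are determined by the edge sources and the partial sums at the vertices. -/
theorem eq_of_partialSum_eq {x y : Src1 G → M} (he : ∀ e, x (Sum.inr e) = y (Sum.inr e))
    (hs : ∀ i, partialSum G (A1 G i) x = partialSum G (A1 G i) y) : x = y := by
  funext s
  rcases s with i | e
  · have h := hs i
    unfold partialSum at h
    rw [Fintype.sum_sum_type, Fintype.sum_sum_type] at h
    have h2 : ∑ e, (A1 G i).indicator x (Sum.inr e) = ∑ e, (A1 G i).indicator y (Sum.inr e) := by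
      refine Finset.sum_congr rfl fun e _ => ?_
      classical
      simp only [Set.indicator_apply, he]
    have h1 : ∀ z : Src1 G → M, ∑ v, (A1 G i).indicator z (Sum.inl v) = z (Sum.inl i) := by
      intro z
      classical
      have hm : ∀ v, (Sum.inl v : Src1 G) ∈ A1 G i ↔ v = i := fun v => Iff.rfl
      simp [Set.indicator_apply, hm]
    rw [h2, h1, h1] at h
    exact add_right_cancel h
  · exact he e

end Sources

section Codes

variable {V : Type} [Fintype V] [DecidableEq V] (G : SimpleGraph V) [DecidableRel G.Adj]
  (A : Type) [Field A] [Fintype A]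

/-- The bottleneck symbols of a Construction-1 code determine all sources. -/
theorem IsCode1.injective {r l α : ℕ}
    {φ : ∀ i : V, (↥(A1 G i) → (Fin r → A)) → (Fin (α * l) → A)}
    (h : IsCode1 G A r l α φ) :
    Function.Injective fun (x : Src1 G → (Fin r → A)) (i : V) => φ i fun a => x a.1 := by
  obtain ⟨hv, hedge, -⟩ := h
  intro x y hxy
  have hφ : ∀ i, φ i (fun a => x a.1) = φ i (fun a => y a.1) := fun i => congrFun hxy i
  have restr : ∀ (T : Set (Src1 G)) (i : V), A1 G i ⊆ T → ∀ z : Src1 G → (Fin r → A),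
      (fun a : ↥(A1 G i) => T.indicator z a.1) = fun a => z a.1 := fun T i hT z =>
    funext fun a => Set.indicator_of_mem (hT a.2) z
  have compl : ∀ T : Set (Src1 G), ∀ z : Src1 G → (Fin r → A),
      (fun a : ↥(Tᶜ) => T.indicator z a.1) = fun _ => 0 := fun T z =>
    funext fun a => Set.indicator_of_notMem a.2 z
  have hs : ∀ i, partialSum G (A1 G i) x = partialSum G (A1 G i) y := by
    intro i
    obtain ⟨ψ, hψ⟩ := hv i
    unfold partialSum
    rw [← hψ, ← hψ, restr _ i subset_rfl, restr _ i subset_rfl, compl, compl, hφ]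
  refine eq_of_partialSum_eq G ?_ hs
  rintro ⟨e, he⟩
  induction e with | _ i j
  have hadj : G.Adj i j := he
  have hu : partialSum G (A1 G i ∪ A1 G j) x = partialSum G (A1 G i ∪ A1 G j) y := by
    obtain ⟨ψ, hψ⟩ := hedge i j hadj
    unfold partialSum
    rw [← hψ, ← hψ, restr _ i Set.subset_union_left, restr _ i Set.subset_union_left,
      restr _ j Set.subset_union_right, restr _ j Set.subset_union_right, compl, compl, hφ, hφ]
  have hx := partialSum_union G hadj x
  rw [hu, hs i, hs j, ← partialSum_union G hadj y] at hx
  exact add_left_cancel hx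

/-- The rate bound of a Construction-1 code on an arbitrary graph. -/
theorem IsCode1.rate_le {r l α : ℕ}
    {φ : ∀ i : V, (↥(A1 G i) → (Fin r → A)) → (Fin (α * l) → A)}
    (h : IsCode1 G A r l α φ) :
    r * (Fintype.card V + G.edgeFinset.card) ≤ α * l * Fintype.card V := by
  have hc := Fintype.card_le_of_injective _ (IsCode1.injective G A h)
  simp only [Fintype.card_fun, Fintype.card_fin, Fintype.card_sum, ← pow_mul] at hc
  rw [SimpleGraph.edgeFinset_card]
  exact (Nat.pow_le_pow_iff_right Fintype.one_lt_card).1 hc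

open Classical in
/-- The encoder at `i` that sends, in blocks indexed by `D`, the sources of the edges from `i` to
its out-neighbours `out i d`; a block whose `out i d` is not adjacent to `i` holds the sum of the
sources available at `i`. -/
noncomputable def orientedEncoder {D : Type} (out : V → D → V) {r m : ℕ}
    (e : Fin m ≃ D × Fin r) (i : V) (u : ↥(A1 G i) → (Fin r → A)) : Fin m → A := fun t =>
  if h : G.Adj i (out i (e t).1) then
    u ⟨Sum.inr ⟨s(i, out i (e t).1), h⟩, Sym2.mem_mk_left _ _⟩ (e t).2
  else (∑ s, if hs : s ∈ A1 G i then u ⟨s, hs⟩ else 0) (e t).2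

theorem isCode1_orientedEncoder {D : Type} (out : V → D → V) {r l α : ℕ}
    (e : Fin (α * l) ≃ D × Fin r) (hloop : ∀ i, ∃ d, ¬ G.Adj i (out i d))
    (hout : ∀ i j, G.Adj i j → ∃ d, out i d = j ∨ out j d = i) :
    IsCode1 G A r l α (orientedEncoder G A out e) := by
  have hs : ∀ (i : V) (x y : Src1 G → (Fin r → A)),
      orientedEncoder G A out e i (fun a => x a.1) = orientedEncoder G A out e i (fun a => y a.1) →
      partialSum G (A1 G i) x = partialSum G (A1 G i) y := by
    intro i x y hxy
    obtain ⟨d, hd⟩ := hloop i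
    funext c
    have := congrFun hxy (e.symm (d, c))
    simpa [orientedEncoder, hd, partialSum, Set.indicator] using this
  have hsend : ∀ (i : V) (d : D) (h : G.Adj i (out i d)) (x y : Src1 G → (Fin r → A)),
      orientedEncoder G A out e i (fun a => x a.1) = orientedEncoder G A out e i (fun a => y a.1) →
      x (Sum.inr ⟨s(i, out i d), h⟩) = y (Sum.inr ⟨s(i, out i d), h⟩) := by
    intro i d hd x y hxy
    funext c
    have := congrFun hxy (e.symm (d, c))
    simpa [orientedEncoder, hd] using this
  have hedge : ∀ (i j : V) (h : G.Adj i j) (x y : Src1 G → (Fin r → A)),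
      orientedEncoder G A out e i (fun a => x a.1) = orientedEncoder G A out e i (fun a => y a.1) →
      orientedEncoder G A out e j (fun a => x a.1) = orientedEncoder G A out e j (fun a => y a.1) →
      x (Sum.inr ⟨s(i, j), h⟩) = y (Sum.inr ⟨s(i, j), h⟩) := by
    intro i j h x y hi hj
    obtain ⟨d, rfl | rfl⟩ := hout i j h
    · exact hsend i d h x y hi
    · have hsym : (⟨s(out j d, j), h⟩ : ↥G.edgeSet) = ⟨s(j, out j d), h.symm⟩ :=
        Subtype.ext Sym2.eq_swap
      rw [hsym]
      exact hsend j d h.symm x y hj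
  have hcompl : ∀ (T : Set (Src1 G)) (x y : Src1 G → (Fin r → A)),
      (fun a : ↥(Tᶜ) => x a.1) = (fun a => y a.1) → partialSum G Tᶜ x = partialSum G Tᶜ y :=
    fun T x y hxy => partialSum_congr G fun s hs => congrFun hxy ⟨s, hs⟩
  refine ⟨fun i => ?_, fun i j h => ?_, ?_⟩
  · obtain ⟨ψ, hψ⟩ := exists_decoder
      (fun x : Src1 G → (Fin r → A) => (orientedEncoder G A out e i (fun a => x a.1),
        fun a : ↥((A1 G i)ᶜ) => x a.1)) (fun x => ∑ s, x s) (by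
        intro x y hxy
        obtain ⟨h1, h2⟩ := Prod.mk.inj hxy
        rw [← partialSum_add_compl G (A1 G i) x, ← partialSum_add_compl G (A1 G i) y,
          hs i x y h1, hcompl _ x y h2])
    exact ⟨fun a b => ψ (a, b), hψ⟩
  · obtain ⟨ψ, hψ⟩ := exists_decoder
      (fun x : Src1 G → (Fin r → A) => (orientedEncoder G A out e i (fun a => x a.1),
        orientedEncoder G A out e j (fun a => x a.1),
        fun a : ↥((A1 G i ∪ A1 G j)ᶜ) => x a.1)) (fun x => ∑ s, x s) (by
        intro x y hxy
        obtain ⟨h1, h23⟩ := Prod.mk.inj hxy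
        obtain ⟨h2, h3⟩ := Prod.mk.inj h23
        have hu : partialSum G (A1 G i ∪ A1 G j) x = partialSum G (A1 G i ∪ A1 G j) y := by
          have hx := partialSum_union G h x
          rw [hs i x y h1, hs j x y h2, ← partialSum_union G h y, hedge i j h x y h1 h2] at hx
          exact add_right_cancel hx
        rw [← partialSum_add_compl G (A1 G i ∪ A1 G j) x,
          ← partialSum_add_compl G (A1 G i ∪ A1 G j) y, hu, hcompl _ x y h3])
    exact ⟨fun a b c => ψ (a, b, c), hψ⟩
  · refine exists_decoder
      (fun (x : Src1 G → (Fin r → A)) (i : V) => orientedEncoder G A out e i fun a => x a.1)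
      (fun x => ∑ s, x s) fun x y hxy => ?_
    have hφ := fun i => congrFun hxy i
    have : x = y := by
      refine eq_of_partialSum_eq G ?_ fun i => hs i x y (hφ i)
      rintro ⟨e', he⟩
      induction e' with | _ i j
      exact hedge i j he x y (hφ i) (hφ j)
    rw [this]

end Codes

/-- In the cyclic order on `2 * q - 1` points, one of any two points is reached from the other by a
shift of less than `q`. -/
theorem exists_cyclic_shift {q : ℕ} (i j : Fin (2 * q - 1)) :
    ∃ d : Fin q, ((i : ℕ) + d) % (2 * q - 1) = j ∨ ((j : ℕ) + d) % (2 * q - 1) = i := by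
  obtain ⟨i, hi⟩ := i
  obtain ⟨j, hj⟩ := j
  have key : ∀ a b, a ≤ b → b < 2 * q - 1 →
      ∃ d : Fin q, (a + d) % (2 * q - 1) = b ∨ (b + d) % (2 * q - 1) = a := by
    intro a b hab hb
    by_cases hd : b - a < q
    · refine ⟨⟨b - a, hd⟩, Or.inl ?_⟩
      rw [Nat.add_sub_cancel' hab, Nat.mod_eq_of_lt hb]
    · refine ⟨⟨2 * q - 1 - (b - a), by omega⟩, Or.inr ?_⟩
      have : b + (2 * q - 1 - (b - a)) = a + (2 * q - 1) := by omega
      rw [this, Nat.add_mod_right, Nat.mod_eq_of_lt (by omega)]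
  rcases le_total i j with h | h
  · exact key i j h hj
  · obtain ⟨d, hd⟩ := key j i h hi
    exact ⟨d, hd.symm⟩

/-- **Recovering the Rai–Das result.** For integers `p ≥ 1`, `q ≥ 2` and any finite field
`A`, the Construction-1 sum-network built from the complete graph `K_{2q-1}` with
bottleneck capacity `α = p` has capacity exactly `p/q`: there is a Construction-1
`(p(2q-1), q(2q-1))`-code of capacity `p` (note `|Ṽ| + |Ẽ| = (2q-1) + (2q-1)(q-1)
= q(2q-1)`), and every Construction-1 `(r,l)`-code of capacity `p` satisfies
`r·q ≤ l·p`. -/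
theorem complete_graph_capacity (p q : ℕ) (hp : 1 ≤ p) (hq : 2 ≤ q)
    (A : Type) [Field A] [Fintype A] :
    (∃ φ : ∀ i : Fin (2 * q - 1),
        (↥(A1 (⊤ : SimpleGraph (Fin (2 * q - 1))) i) → (Fin (p * (2 * q - 1)) → A)) →
        (Fin (p * (q * (2 * q - 1))) → A),
      IsCode1 (⊤ : SimpleGraph (Fin (2 * q - 1))) A (p * (2 * q - 1)) (q * (2 * q - 1)) p φ) ∧
    (∀ r l : ℕ, 0 < r → 0 < l →
      (∃ φ : ∀ i : Fin (2 * q - 1),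
          (↥(A1 (⊤ : SimpleGraph (Fin (2 * q - 1))) i) → (Fin r → A)) → (Fin (p * l) → A),
        IsCode1 (⊤ : SimpleGraph (Fin (2 * q - 1))) A r l p φ) →
      r * q ≤ l * p) := by
  have hn : 0 < 2 * q - 1 := by omega
  constructor
  · let e : Fin (p * (q * (2 * q - 1))) ≃ Fin q × Fin (p * (2 * q - 1)) :=
      Fintype.equivOfCardEq (by
        simp only [Fintype.card_prod, Fintype.card_fin]
        exact Nat.mul_left_comm _ _ _)
    let out : Fin (2 * q - 1) → Fin q → Fin (2 * q - 1) := fun i d =>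
      ⟨((i : ℕ) + d) % (2 * q - 1), Nat.mod_lt _ hn⟩
    refine ⟨orientedEncoder ⊤ A out e, isCode1_orientedEncoder ⊤ A out e (fun i => ?_) ?_⟩
    · refine ⟨⟨0, by omega⟩, ?_⟩
      have : out i ⟨0, by omega⟩ = i := Fin.ext (Nat.mod_eq_of_lt i.2)
      rw [this]
      exact SimpleGraph.irrefl _
    · intro i j _
      obtain ⟨d, hd⟩ := exists_cyclic_shift i j
      exact ⟨d, hd.imp (fun h => Fin.ext h) fun h => Fin.ext h⟩
  · rintro r l - - ⟨φ, hφ⟩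
    have h := IsCode1.rate_le _ A hφ
    have hcard : 2 * q - 1 + (2 * q - 1).choose 2 = q * (2 * q - 1) := by
      obtain ⟨k, rfl⟩ : ∃ k, q = k + 1 := ⟨q - 1, by omega⟩
      have h2 : 2 * (k + 1) - 1 = 2 * k + 1 := by omega
      rw [h2, Nat.choose_two_right, Nat.add_sub_cancel, Nat.mul_left_comm,
        Nat.mul_div_cancel_left _ two_pos]
      ring
    rw [SimpleGraph.card_edgeFinset_top_eq_card_choose_two, Fintype.card_fin, hcard,
      ← mul_assoc] at h
    rw [mul_comm l p]
    exact Nat.le_of_mul_le_mul_right h hn
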